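/- Let Ω be a probability space, let X : Ω → 𝒳 and Y : Ω → 𝒴 be measurable random variables with 𝒳 and 𝒴 finite, and let a > 0 be a real number. Let 𝒮 be a set of selectors, where each s ∈ 𝒮 determines functions φ_s : 𝒳 → 𝒰 and ψ_s : 𝒳 → 𝒱 into finite types, and define the selector loss L(s) = H[Y | φ_s ∘ X] − a · H[Y | ψ_s ∘ X]. Suppose there exists a ground-truth selector s* ∈ 𝒮 with H[Y | φ_{s*} ∘ X] = H[Y | X] and H[Y | ψ_{s*} ∘ X] = H[Y]. Then any selector ŝ ∈ 𝒮 minimizing L over 𝒮 (i.e. L(ŝ) ≤ L(s) for all s ∈ 𝒮) satisfies both sufficiency, H[Y | φ_{ŝ} ∘ X] = H[Y | X], and completeness, H[Y | ψ_{ŝ} ∘ X] = H[Y]. -/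

import Mathlib

open scoped BigOperators
open Real

/-- Probability that a finite-valued random variable takes a given value. -/
noncomputable def probOf {Ω α : Type*} [MeasurableSpace Ω]
    (μ : MeasureTheory.Measure Ω) (X : Ω → α) (x : α) : ℝ :=
  (μ (X ⁻¹' {x})).toReal

/-- Joint probability `P(Y = y, Z = z)` for finite-valued random variables. -/
noncomputable def jointProb {Ω α β : Type*} [MeasurableSpace Ω]
    (μ : MeasureTheory.Measure Ω) (Y : Ω → α) (Z : Ω → β) (y : α) (z : β) : ℝ :=
  (μ (Y ⁻¹' {y} ∩ Z ⁻¹' {z})).toReal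

/-- Shannon entropy `H[Y] = -∑ y, P(Y = y) log P(Y = y)` of a finite-valued random variable. -/
noncomputable def shannonEntropy {Ω α : Type*} [MeasurableSpace Ω] [Fintype α]
    (μ : MeasureTheory.Measure Ω) (Y : Ω → α) : ℝ :=
  -∑ y, probOf μ Y y * Real.log (probOf μ Y y)

/-- Shannon conditional entropy
`H[Y | Z] = ∑ z, P(Z = z) * (-∑ y, P(Y = y | Z = z) log P(Y = y | Z = z))`
for finite-valued random variables, with `P(Y = y | Z = z) = P(Y = y, Z = z) / P(Z = z)`. -/
noncomputable def shannonCondEntropy {Ω α β : Type*} [MeasurableSpace Ω] [Fintype α] [Fintype β]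
    (μ : MeasureTheory.Measure Ω) (Y : Ω → α) (Z : Ω → β) : ℝ :=
  ∑ z, probOf μ Z z *
    (-∑ y, (jointProb μ Y Z y z / probOf μ Z z) *
      Real.log (jointProb μ Y Z y z / probOf μ Z z))

/-- Perspective form of Jensen's inequality for the concave function `Real.negMulLog`. -/
theorem sum_mul_negMulLog_div_le {ι : Type*} (s : Finset ι) (p j : ι → ℝ)
    (hj : ∀ i, 0 ≤ j i) (hjp : ∀ i, j i ≤ p i) :
    ∑ i ∈ s, p i * negMulLog (j i / p i) ≤
      (∑ i ∈ s, p i) * negMulLog ((∑ i ∈ s, j i) / ∑ i ∈ s, p i) := by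
  have hp : ∀ i, 0 ≤ p i := fun i => (hj i).trans (hjp i)
  rcases (Finset.sum_nonneg fun i _ => hp i : 0 ≤ ∑ i ∈ s, p i).eq_or_lt with h0 | hpos
  · have hz := (Finset.sum_eq_zero_iff_of_nonneg fun i _ => hp i).1 h0.symm
    rw [← h0, zero_mul]
    exact (Finset.sum_eq_zero fun i hi => by rw [hz i hi, zero_mul]).le
  · have hjensen := concaveOn_negMulLog.le_map_centerMass (t := s) (w := p)
      (p := fun i => j i / p i) (fun i _ => hp i) hpos
      (fun i _ => div_nonneg (hj i) (hp i))
    have hmul : ∀ i, p i * (j i / p i) = j i := fun i =>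
      mul_div_cancel_of_imp' fun h => le_antisymm (h ▸ hjp i) (hj i)
    simp only [Finset.centerMass, smul_eq_mul, Function.comp_apply, hmul] at hjensen
    rwa [inv_mul_le_iff₀ hpos, inv_mul_eq_div] at hjensen

theorem shannonCondEntropy_eq_sum_negMulLog {Ω α β : Type*} [MeasurableSpace Ω] [Fintype α]
    [Fintype β] (μ : MeasureTheory.Measure Ω) (Y : Ω → α) (Z : Ω → β) :
    shannonCondEntropy μ Y Z =
      ∑ y, ∑ z, probOf μ Z z * negMulLog (jointProb μ Y Z y z / probOf μ Z z) := by
  rw [Finset.sum_comm]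
  simp only [shannonCondEntropy, negMulLog_def, ← Finset.mul_sum, neg_mul, Finset.sum_neg_distrib]

theorem jointProb_comp_eq_sum {Ω α β γ : Type*} [MeasurableSpace Ω] [Fintype β] [DecidableEq γ]
    (μ : MeasureTheory.Measure Ω) [MeasureTheory.IsFiniteMeasure μ] (Y : Ω → α) (Z : Ω → β)
    (hY : ∀ y, MeasurableSet (Y ⁻¹' {y})) (hZ : ∀ z, MeasurableSet (Z ⁻¹' {z}))
    (g : β → γ) (y : α) (u : γ) :
    jointProb μ Y (g ∘ Z) y u = ∑ z with g z = u, jointProb μ Y Z y z := by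
  have hset : Y ⁻¹' {y} ∩ (g ∘ Z) ⁻¹' {u} =
      ⋃ z ∈ Finset.univ.filter (fun z => g z = u), Y ⁻¹' {y} ∩ Z ⁻¹' {z} := by
    ext ω
    simp
  change μ.real _ = ∑ z with g z = u, μ.real _
  rw [hset, MeasureTheory.measureReal_biUnion_finset]
  · intro z _ z' _ hne
    exact ((Set.disjoint_singleton.2 hne).preimage Z).mono
      Set.inter_subset_right Set.inter_subset_right
  · exact fun z _ => (hY y).inter (hZ z)

theorem probOf_eq_jointProb_const {Ω β : Type*} [MeasurableSpace Ω]
    (μ : MeasureTheory.Measure Ω) (Z : Ω → β) (z : β) :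
    probOf μ Z z = jointProb μ (fun _ => ()) Z () z := by
  simp [probOf, jointProb]

/-- Conditioning on a function of `Z` instead of `Z` cannot decrease the conditional entropy. -/
theorem shannonCondEntropy_le_comp {Ω α β γ : Type*} [MeasurableSpace Ω] [Fintype α] [Fintype β]
    [Fintype γ] (μ : MeasureTheory.Measure Ω) [MeasureTheory.IsFiniteMeasure μ] (Y : Ω → α)
    (Z : Ω → β) (hY : ∀ y, MeasurableSet (Y ⁻¹' {y})) (hZ : ∀ z, MeasurableSet (Z ⁻¹' {z}))
    (g : β → γ) :
    shannonCondEntropy μ Y Z ≤ shannonCondEntropy μ Y (g ∘ Z) := by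
  classical
  rw [shannonCondEntropy_eq_sum_negMulLog, shannonCondEntropy_eq_sum_negMulLog]
  refine Finset.sum_le_sum fun y _ => ?_
  rw [← Finset.sum_fiberwise Finset.univ g]
  refine Finset.sum_le_sum fun u _ => ?_
  have hprob : probOf μ (g ∘ Z) u = ∑ z with g z = u, probOf μ Z z := by
    simp only [probOf_eq_jointProb_const]
    exact jointProb_comp_eq_sum μ _ Z (fun _ => by simp) hZ g () u
  rw [hprob, jointProb_comp_eq_sum μ Y Z hY hZ]
  exact sum_mul_negMulLog_div_le _ _ _ (fun _ => ENNReal.toReal_nonneg)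
    (fun _ => MeasureTheory.measureReal_mono Set.inter_subset_right)

theorem shannonCondEntropy_const {Ω α : Type*} [MeasurableSpace Ω] [Fintype α]
    (μ : MeasureTheory.Measure Ω) [MeasureTheory.IsProbabilityMeasure μ] (Y : Ω → α) :
    shannonCondEntropy μ Y (fun _ => ()) = shannonEntropy μ Y := by
  simp [shannonCondEntropy, shannonEntropy, probOf, jointProb]

/-- Optimal Selector: if a set `𝒮` of selectors contains a ground-truth selector `s*`
satisfying sufficiency (`H[Y | φ_{s*} ∘ X] = H[Y | X]`) and completeness
(`H[Y | ψ_{s*} ∘ X] = H[Y]`), then any minimizer `ŝ ∈ 𝒮` of the selector loss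
`L(s) = H[Y | φ_s ∘ X] - a * H[Y | ψ_s ∘ X]` over `𝒮` also satisfies both
sufficiency and completeness. -/
theorem optimal_selector_sufficient_and_complete
    {Ω 𝒳 𝒴 𝒰 𝒱 σ : Type*} [MeasurableSpace Ω]
    [MeasurableSpace 𝒳] [MeasurableSingletonClass 𝒳] [Fintype 𝒳]
    [MeasurableSpace 𝒴] [MeasurableSingletonClass 𝒴] [Fintype 𝒴]
    [Fintype 𝒰] [Fintype 𝒱]
    (μ : MeasureTheory.Measure Ω) [MeasureTheory.IsProbabilityMeasure μ]
    (X : Ω → 𝒳) (Y : Ω → 𝒴) (hX : Measurable X) (hY : Measurable Y)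
    (a : ℝ) (ha : 0 < a)
    (𝒮 : Set σ) (φ : σ → 𝒳 → 𝒰) (ψ : σ → 𝒳 → 𝒱)
    (L : σ → ℝ)
    (hL : ∀ s, L s = shannonCondEntropy μ Y (φ s ∘ X)
        - a * shannonCondEntropy μ Y (ψ s ∘ X))
    (sstar : σ) (hstar_mem : sstar ∈ 𝒮)
    (hstar_suff : shannonCondEntropy μ Y (φ sstar ∘ X) = shannonCondEntropy μ Y X)
    (hstar_comp : shannonCondEntropy μ Y (ψ sstar ∘ X) = shannonEntropy μ Y)
    (shat : σ) (hhat_mem : shat ∈ 𝒮)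
    (hhat_min : ∀ s ∈ 𝒮, L shat ≤ L s) :
    shannonCondEntropy μ Y (φ shat ∘ X) = shannonCondEntropy μ Y X ∧
    shannonCondEntropy μ Y (ψ shat ∘ X) = shannonEntropy μ Y := by
  have hYm : ∀ y, MeasurableSet (Y ⁻¹' {y}) := fun y => hY (measurableSet_singleton y)
  have hXm : ∀ x, MeasurableSet (X ⁻¹' {x}) := fun x => hX (measurableSet_singleton x)
  have hφ := shannonCondEntropy_le_comp μ Y X hYm hXm (φ shat)
  have hψ : shannonCondEntropy μ Y (ψ shat ∘ X) ≤ shannonEntropy μ Y := by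
    rw [← shannonCondEntropy_const μ Y]
    exact shannonCondEntropy_le_comp μ Y (ψ shat ∘ X) hYm
      (fun v => hX (Set.toFinite (ψ shat ⁻¹' {v})).measurableSet) (fun _ => ())
  have hmin := hhat_min sstar hstar_mem
  rw [hL, hL, hstar_suff, hstar_comp] at hmin
  have hmul := mul_le_mul_of_nonneg_left hψ ha.le
  exact ⟨by linarith, le_antisymm hψ (le_of_mul_le_mul_left (by linarith) ha)⟩
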